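/- Let T be a tiered tree on the vertex set {1,…,n} with tiering function t, and let K_t be the complete tiered graph with respect to t, i.e., the graph on {1,…,n} having an edge between every pair of vertices v > v' with t(v) > t(v') (so T is a spanning tree of K_t). Order the edges of K_t lexicographically by their pairs of endpoints. Then the weight w(T) equals the external activity of T in K_t. -/

import Mathlib

open scoped Classical

/-- Reachability along a finite edge set (edges are unordered pairs of naturals). -/
def EReach (E : Finset (Sym2 ℕ)) : ℕ → ℕ → Prop :=
  Relation.ReflTransGen fun a b => s(a, b) ∈ E

/-- `E` is the edge set of a tree on the vertex set `V`: all edges join distinct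
vertices of `V`, any two vertices of `V` are joined by a walk, and the number of
edges is one less than the number of vertices. -/
def IsTreeOn (V : Finset ℕ) (E : Finset (Sym2 ℕ)) : Prop :=
  (∀ e ∈ E, ∀ x ∈ e, x ∈ V) ∧ (∀ e ∈ E, ¬ e.IsDiag) ∧
    (∀ a ∈ V, ∀ b ∈ V, EReach E a b) ∧ E.card + 1 = V.card

/-- `t` is a tiering function (with tiers `1, …, m`) for the graph with vertex set `V`
and edge set `E`: tiers lie in `{1, …, m}` and if `a < b` are adjacent then `t a < t b`. -/
def IsTieredOn (V : Finset ℕ) (E : Finset (Sym2 ℕ)) (m : ℕ) (t : ℕ → ℕ) : Prop :=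
  (∀ v ∈ V, t v ∈ Finset.Icc 1 m) ∧ ∀ a b : ℕ, s(a, b) ∈ E → a < b → t a < t b

/-- Auxiliary fuelled recursion computing the weight of a tiered tree: delete the
minimal vertex `v`, and sum, over the components `C` of the resulting forest
(one for each neighbour `u` of `v`), the weight of the component plus the number
of vertices `x ∈ C` with `t x > t v` and `x < u`.  (Fuel `V.card` always suffices,
since components are strictly smaller.) -/
noncomputable def treeWeightAux (t : ℕ → ℕ) : ℕ → Finset ℕ → Finset (Sym2 ℕ) → ℕ
  | 0, _, _ => 0
  | fuel + 1, V, E =>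
    if h : 2 ≤ V.card then
      let v := V.min' (Finset.card_pos.mp (by omega))
      let E' := E.filter fun e => v ∉ e
      ((V.erase v).filter fun u => s(v, u) ∈ E).sum fun u =>
        let C := (V.erase v).filter fun x => EReach E' u x
        (C.filter fun x => t v < t x ∧ x < u).card +
          treeWeightAux t fuel C (E'.filter fun e => ∀ x ∈ e, x ∈ C)
    else 0

/-- The weight of a tiered tree with vertex set `V`, edge set `E` and tiering function `t`. -/
noncomputable def treeWeight (V : Finset ℕ) (E : Finset (Sym2 ℕ)) (t : ℕ → ℕ) : ℕ :=
  treeWeightAux t V.card V E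

/-- The (smaller, larger) endpoints of an edge. -/
def edgeKey (e : Sym2 ℕ) : ℕ × ℕ :=
  Sym2.lift ⟨fun a b => (min a b, max a b), fun a b => by simp [min_comm, max_comm]⟩ e

/-- Lexicographic comparison of edges by their ordered pairs of endpoints. -/
def edgeLexLt (e f : Sym2 ℕ) : Prop :=
  (edgeKey e).1 < (edgeKey f).1 ∨ ((edgeKey e).1 = (edgeKey f).1 ∧ (edgeKey e).2 < (edgeKey f).2)

/-- The complete tiered graph on vertex set `V` with respect to `t`: there is an
edge between every pair of vertices `a < b` with `t a < t b`. -/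
def completeTiered (V : Finset ℕ) (t : ℕ → ℕ) : Finset (Sym2 ℕ) :=
  ((V ×ˢ V).filter fun p => p.1 < p.2 ∧ t p.1 < t p.2).image fun p => s(p.1, p.2)

/-- `e` is externally active for the spanning tree `T` of `K` (edges ordered
lexicographically by endpoints): `e ∈ K \ T` and `e` is the least edge of the unique
cycle of `T ∪ {e}`, i.e. `e` is smaller than every edge `f` of `T` whose removal
disconnects the endpoints of `e` (these `f`, together with `e`, form that cycle). -/
def ExtActive (T K : Finset (Sym2 ℕ)) (e : Sym2 ℕ) : Prop :=
  e ∈ K ∧ e ∉ T ∧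
    ∀ f ∈ T, ¬ EReach (T.erase f) (edgeKey e).1 (edgeKey e).2 → edgeLexLt e f

/-- The external activity of `T` in `K`: the number of externally active edges. -/
noncomputable def extActivity (T K : Finset (Sym2 ℕ)) : ℕ :=
  (K.filter (ExtActive T K)).card

theorem EReach.mono {E F : Finset (Sym2 ℕ)} (h : E ⊆ F) {a b : ℕ} (hab : EReach E a b) :
    EReach F a b :=
  Relation.ReflTransGen.mono (fun _ _ he => h he) _ _ hab

theorem EReach.symm {E : Finset (Sym2 ℕ)} {a b : ℕ} (h : EReach E a b) : EReach E b a := by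
  induction h with
  | refl => exact .refl
  | tail _ he ih => exact .head (by rwa [Sym2.eq_swap]) ih

theorem EReach.trans {E : Finset (Sym2 ℕ)} {a b c : ℕ} (h : EReach E a b) (h' : EReach E b c) :
    EReach E a c :=
  Relation.ReflTransGen.trans h h'

theorem EReach.of_mem {E : Finset (Sym2 ℕ)} {a b : ℕ} (h : s(a, b) ∈ E) : EReach E a b :=
  Relation.ReflTransGen.single h

/-- A walk either avoids the edge `s(p, q)` or can be cut at its endpoints. -/
theorem EReach.erase_cases {E : Finset (Sym2 ℕ)} {a b : ℕ} (p q : ℕ) (h : EReach E a b) :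
    EReach (E.erase s(p, q)) a b ∨
      (EReach (E.erase s(p, q)) a p ∧ EReach (E.erase s(p, q)) q b) ∨
      (EReach (E.erase s(p, q)) a q ∧ EReach (E.erase s(p, q)) p b) := by
  induction h with
  | refl => exact .inl .refl
  | @tail y z _ he ih =>
    by_cases hf : s(y, z) = s(p, q)
    · rcases Sym2.eq_iff.mp hf with ⟨rfl, rfl⟩ | ⟨rfl, rfl⟩
      · rcases ih with h | ⟨h, _⟩ | ⟨h, _⟩
        · exact .inr (.inl ⟨h, .refl⟩)
        · exact .inr (.inl ⟨h, .refl⟩)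
        · exact .inl h
      · rcases ih with h | ⟨h, _⟩ | ⟨h, _⟩
        · exact .inr (.inr ⟨h, .refl⟩)
        · exact .inl h
        · exact .inr (.inr ⟨h, .refl⟩)
    · have hs : EReach (E.erase s(p, q)) y z := .of_mem (Finset.mem_erase.mpr ⟨hf, he⟩)
      rcases ih with h | ⟨h, h'⟩ | ⟨h, h'⟩
      · exact .inl (h.trans hs)
      · exact .inr (.inl ⟨h, h'.trans hs⟩)
      · exact .inr (.inr ⟨h, h'.trans hs⟩)

/-- A connected graph on `V` all of whose edges are bridges. -/
structure IsBridgeTree (V : Finset ℕ) (E : Finset (Sym2 ℕ)) : Prop where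
  mem : ∀ a b, s(a, b) ∈ E → a ∈ V ∧ b ∈ V
  conn : ∀ a ∈ V, ∀ b ∈ V, EReach E a b
  bridge : ∀ a b, s(a, b) ∈ E → ¬ EReach (E.erase s(a, b)) a b

theorem card_le_of_connected {V : Finset ℕ} {E : Finset (Sym2 ℕ)}
    (hmem : ∀ a b, s(a, b) ∈ E → a ∈ V ∧ b ∈ V) (hne : V.Nonempty)
    (hconn : ∀ a ∈ V, ∀ b ∈ V, EReach E a b) : V.card ≤ E.card + 1 := by
  let G : SimpleGraph V :=
    { Adj := fun a b => a ≠ b ∧ s((a : ℕ), (b : ℕ)) ∈ E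
      symm := ⟨fun a b h => ⟨h.1.symm, by rw [Sym2.eq_swap]; exact h.2⟩⟩
      loopless := ⟨fun a h => h.1 rfl⟩ }
  have hreach : ∀ (a : V) (b : ℕ), EReach E a b → ∃ hb : b ∈ V, G.Reachable a ⟨b, hb⟩ := by
    intro a b h
    induction h with
    | refl => exact ⟨a.2, .refl _⟩
    | @tail y z _ he ih =>
      obtain ⟨hy, hr⟩ := ih
      refine ⟨(hmem _ _ he).2, ?_⟩
      by_cases hyz : y = z
      · subst hyz; exact hr
      · exact hr.trans (SimpleGraph.Adj.reachable (G := G) ⟨by simpa using hyz, he⟩)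
  have hG : G.Connected := by
    have : Nonempty V := hne.to_subtype
    exact ⟨fun a b => (hreach a b (hconn a a.2 b b.2)).2⟩
  have h1 := hG.card_vert_le_card_edgeSet_add_one
  have h2 : Nat.card G.edgeSet ≤ E.card := by
    rw [← Nat.card_eq_finsetCard E]
    refine Nat.card_le_card_of_injective
      (fun e : G.edgeSet => (⟨Sym2.map Subtype.val e.1, ?_⟩ : E)) ?_
    · obtain ⟨e, he⟩ := e
      induction e with
      | _ a b => exact he.2
    · intro e f hef
      exact Subtype.ext (Sym2.map.injective Subtype.val_injective (congrArg Subtype.val hef))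
  rw [Nat.card_eq_finsetCard V] at h1
  omega

theorem isBridgeTree_of_isTreeOn {V : Finset ℕ} {E : Finset (Sym2 ℕ)} (h : IsTreeOn V E) :
    IsBridgeTree V E := by
  obtain ⟨hmem, -, hconn, hcard⟩ := h
  have hmem' : ∀ a b, s(a, b) ∈ E → a ∈ V ∧ b ∈ V := fun a b he =>
    ⟨hmem _ he a (by simp), hmem _ he b (by simp)⟩
  refine ⟨hmem', hconn, fun p q hpq hr => ?_⟩
  have hle := card_le_of_connected (V := V) (E := E.erase s(p, q))
    (fun a b he => hmem' a b (Finset.mem_of_mem_erase he)) ⟨p, (hmem' p q hpq).1⟩ (by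
      intro a ha b hb
      rcases (hconn a ha b hb).erase_cases p q with h | ⟨h, h'⟩ | ⟨h, h'⟩
      · exact h
      · exact h.trans (hr.trans h')
      · exact h.trans (hr.symm.trans h'))
  have := Finset.card_erase_add_one hpq
  omega

theorem edgeKey_mk {a b : ℕ} (h : a < b) : edgeKey s(a, b) = (a, b) := by
  simp [edgeKey, h.le]

theorem mem_completeTiered {V : Finset ℕ} {t : ℕ → ℕ} {e : Sym2 ℕ} :
    e ∈ completeTiered V t ↔
      ∃ a b, a ∈ V ∧ b ∈ V ∧ a < b ∧ t a < t b ∧ s(a, b) = e := by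
  simp only [completeTiered, Finset.mem_image, Finset.mem_filter, Finset.mem_product, Prod.exists]
  grind

theorem mk_mem_completeTiered {V : Finset ℕ} {t : ℕ → ℕ} {a b : ℕ} (hab : a < b) :
    s(a, b) ∈ completeTiered V t ↔ a ∈ V ∧ b ∈ V ∧ t a < t b := by
  rw [mem_completeTiered]
  constructor
  · rintro ⟨c, d, hc, hd, hcd, ht, he⟩
    rcases Sym2.eq_iff.mp he with ⟨rfl, rfl⟩ | ⟨rfl, rfl⟩
    · exact ⟨hc, hd, ht⟩
    · omega
  · rintro ⟨ha, hb, ht⟩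
    exact ⟨a, b, ha, hb, hab, ht, rfl⟩

/-- The edges avoiding the vertex `v`. -/
noncomputable abbrev avoiding (E : Finset (Sym2 ℕ)) (v : ℕ) : Finset (Sym2 ℕ) :=
  E.filter fun e => v ∉ e

/-- The vertices reachable from `u` after deleting `v`. -/
noncomputable abbrev branch (V : Finset ℕ) (E : Finset (Sym2 ℕ)) (v u : ℕ) : Finset ℕ :=
  (V.erase v).filter fun x => EReach (avoiding E v) u x

/-- The edges of the branch of `u` after deleting `v`. -/
noncomputable abbrev branchEdges (V : Finset ℕ) (E : Finset (Sym2 ℕ)) (v u : ℕ) :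
    Finset (Sym2 ℕ) :=
  (avoiding E v).filter fun e => ∀ x ∈ e, x ∈ branch V E v u

section Branches

variable {V : Finset ℕ} {E : Finset (Sym2 ℕ)} {v u : ℕ}

theorem avoiding_subset_erase (w : ℕ) : avoiding E v ⊆ E.erase s(v, w) := by
  intro e he
  rw [Finset.mem_filter] at he
  refine Finset.mem_erase.mpr ⟨?_, he.1⟩
  rintro rfl
  simp at he

theorem mem_branch_of_step (hE : IsBridgeTree V E) {x y : ℕ} (hx : x ∈ branch V E v u)
    (hxy : s(x, y) ∈ avoiding E v) : y ∈ branch V E v u := by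
  simp only [Finset.mem_filter, Finset.mem_erase] at hx ⊢
  have h := Finset.mem_filter.mp hxy
  refine ⟨⟨?_, (hE.mem _ _ h.1).2⟩, hx.2.trans (.of_mem hxy)⟩
  rintro rfl
  simp at h

theorem EReach.to_branchEdges (hE : IsBridgeTree V E) {x y : ℕ} (hx : x ∈ branch V E v u)
    (h : EReach (avoiding E v) x y) : y ∈ branch V E v u ∧ EReach (branchEdges V E v u) x y := by
  induction h with
  | refl => exact ⟨hx, .refl⟩
  | @tail y z _ he ih =>
    have hz := mem_branch_of_step hE ih.1 he
    refine ⟨hz, ih.2.trans (.of_mem (Finset.mem_filter.mpr ⟨he, ?_⟩))⟩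
    intro w hw
    rcases Sym2.mem_iff.mp hw with rfl | rfl
    exacts [ih.1, hz]

theorem isBridgeTree_branch (hE : IsBridgeTree V E) :
    IsBridgeTree (branch V E v u) (branchEdges V E v u) where
  mem a b h := by
    have h' := (Finset.mem_filter.mp h).2
    exact ⟨h' a (by simp), h' b (by simp)⟩
  conn a ha b hb :=
    (EReach.to_branchEdges hE ha
      ((Finset.mem_filter.mp ha).2.symm.trans (Finset.mem_filter.mp hb).2)).2
  bridge a b h hr :=
    hE.bridge a b (Finset.mem_filter.mp (Finset.mem_filter.mp h).1).1
      (hr.mono (Finset.erase_subset_erase _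
        ((Finset.filter_subset _ _).trans (Finset.filter_subset _ _))))

theorem exists_branch (hE : IsBridgeTree V E) (hv : v ∈ V) {x : ℕ} (hx : x ∈ V) (hxv : x ≠ v) :
    ∃ u, s(v, u) ∈ E ∧ x ∈ branch V E v u := by
  have key : ∀ y, EReach E v y → y = v ∨ ∃ u, s(v, u) ∈ E ∧ EReach (avoiding E v) u y := by
    intro y h
    induction h with
    | refl => exact .inl rfl
    | @tail y z _ he ih =>
      by_cases hz : z = v
      · exact .inl hz
      by_cases hy : y = v
      · exact .inr ⟨z, hy ▸ he, .refl⟩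
      · obtain ⟨u, hu, hr⟩ := ih.resolve_left hy
        refine .inr ⟨u, hu, hr.trans (.of_mem (Finset.mem_filter.mpr ⟨he, ?_⟩))⟩
        simp [Ne.symm hy, Ne.symm hz]
  obtain ⟨u, hu, hr⟩ := (key x (hE.conn v hv x hx)).resolve_left hxv
  exact ⟨u, hu, Finset.mem_filter.mpr ⟨Finset.mem_erase.mpr ⟨hxv, hx⟩, hr⟩⟩

theorem branch_unique (hE : IsBridgeTree V E) {w x : ℕ} (hu : s(v, u) ∈ E) (hw : s(v, w) ∈ E)
    (hxu : x ∈ branch V E v u) (hxw : x ∈ branch V E v w) : u = w := by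
  by_contra hne
  refine hE.bridge v w hw ?_
  have hr : EReach (avoiding E v) u w :=
    (Finset.mem_filter.mp hxu).2.trans (Finset.mem_filter.mp hxw).2.symm
  refine EReach.trans (.of_mem (Finset.mem_erase.mpr ⟨?_, hu⟩))
    (hr.mono (avoiding_subset_erase w))
  exact fun h => hne (Sym2.congr_right.mp h)

theorem ne_of_mem_branch {x : ℕ} (hx : x ∈ branch V E v u) : x ≠ v :=
  (Finset.mem_erase.mp (Finset.mem_filter.mp hx).1).1

theorem mem_of_mem_branch {x : ℕ} (hx : x ∈ branch V E v u) : x ∈ V :=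
  (Finset.mem_erase.mp (Finset.mem_filter.mp hx).1).2

theorem root_mem_branch (hE : IsBridgeTree V E) (hu : s(v, u) ∈ E) : u ∈ branch V E v u := by
  refine Finset.mem_filter.mpr ⟨Finset.mem_erase.mpr ⟨?_, (hE.mem _ _ hu).2⟩, .refl⟩
  rintro rfl
  exact hE.bridge _ _ hu .refl

theorem extActive_min_iff (hE : IsBridgeTree V E) (hv : v ∈ V) (hmin : ∀ x ∈ V, v ≤ x)
    (hu : s(v, u) ∈ E) {x : ℕ} (hx : x ∈ branch V E v u) (t : ℕ → ℕ) :
    ExtActive E (completeTiered V t) s(v, x) ↔ t v < t x ∧ x < u := by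
  have hlt : ∀ {y w}, y ∈ branch V E v w → v < y := fun hy =>
    lt_of_le_of_ne (hmin _ (mem_of_mem_branch hy)) (ne_of_mem_branch hy).symm
  have hvu := hlt (root_mem_branch hE hu)
  have hur := (Finset.mem_filter.mp hx).2
  rw [ExtActive, mk_mem_completeTiered (hlt hx), edgeKey_mk (hlt hx)]
  constructor
  · rintro ⟨⟨-, -, ht⟩, -, h⟩
    have := h _ hu fun hr =>
      hE.bridge v u hu (hr.trans (hur.symm.mono (avoiding_subset_erase u)))
    rw [edgeLexLt, edgeKey_mk (hlt hx), edgeKey_mk hvu] at this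
    simp only [lt_irrefl, true_and, false_or] at this
    exact ⟨ht, this⟩
  · rintro ⟨ht, hxu⟩
    refine ⟨⟨hv, mem_of_mem_branch hx, ht⟩, fun he => ?_, fun f hf hr => ?_⟩
    · exact hxu.ne' (branch_unique hE hu he hx (root_mem_branch hE he))
    · rw [edgeLexLt, edgeKey_mk (hlt hx)]
      by_cases hvf : v ∈ f
      · obtain ⟨w, rfl⟩ := Sym2.mem_iff_exists.mp hvf
        by_cases hwu : w = u
        · subst hwu
          exact .inr (by rw [edgeKey_mk hvu]; exact ⟨rfl, hxu⟩)
        · refine absurd (EReach.trans (.of_mem (Finset.mem_erase.mpr ⟨?_, hu⟩))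
            (hur.mono (avoiding_subset_erase w))) hr
          exact fun h => hwu (Sym2.congr_right.mp h).symm
      · left
        induction f with
        | _ a b =>
          have := hE.mem _ _ hf
          have ha := hmin a this.1
          have hb := hmin b this.2
          simp only [Sym2.mem_iff, not_or] at hvf
          simp only [edgeKey, Sym2.lift_mk]
          omega

theorem not_extActive_of_branch_ne (hE : IsBridgeTree V E) (hmin : ∀ x ∈ V, v ≤ x) {w a b : ℕ}
    (hu : s(v, u) ∈ E) (hw : s(v, w) ∈ E) (huw : u ≠ w) (ha : a ∈ branch V E v u)
    (hb : b ∈ branch V E v w) (hab : a < b) (K : Finset (Sym2 ℕ)) :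
    ¬ ExtActive E K s(a, b) := by
  rintro ⟨-, -, h⟩
  have hvu : v < u := lt_of_le_of_ne (hmin _ (hE.mem _ _ hu).2)
    (ne_of_mem_branch (root_mem_branch hE hu)).symm
  have := h _ hu fun hr => by
    rw [edgeKey_mk hab] at hr
    have h1 := ((Finset.mem_filter.mp ha).2).mono (avoiding_subset_erase u)
    have h2 := ((Finset.mem_filter.mp hb).2).mono (avoiding_subset_erase u)
    have h3 : EReach (E.erase s(v, u)) v w :=
      .of_mem (Finset.mem_erase.mpr ⟨fun h => huw (Sym2.congr_right.mp h).symm, hw⟩)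
    exact hE.bridge v u hu (h3.trans (h2.trans (hr.symm.trans h1.symm)))
  rw [edgeLexLt, edgeKey_mk hab, edgeKey_mk hvu] at this
  have hav := hmin a (mem_of_mem_branch ha)
  have := ne_of_mem_branch ha
  simp only at *
  omega

theorem extActive_branch_iff (hE : IsBridgeTree V E) {a b : ℕ} (ha : a ∈ branch V E v u)
    (hb : b ∈ branch V E v u) (hab : a < b) (t : ℕ → ℕ) :
    ExtActive E (completeTiered V t) s(a, b) ↔
      ExtActive (branchEdges V E v u) (completeTiered (branch V E v u) t) s(a, b) := by
  have hsub : branchEdges V E v u ⊆ E :=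
    (Finset.filter_subset _ _).trans (Finset.filter_subset _ _)
  have hmemE : s(a, b) ∈ branchEdges V E v u ↔ s(a, b) ∈ E := by
    refine ⟨fun h => hsub h, fun h => ?_⟩
    refine Finset.mem_filter.mpr ⟨Finset.mem_filter.mpr ⟨h, ?_⟩, ?_⟩
    · simp [(ne_of_mem_branch ha).symm, (ne_of_mem_branch hb).symm]
    · intro x hx
      rcases Sym2.mem_iff.mp hx with rfl | rfl
      exacts [ha, hb]
  have hT := isBridgeTree_branch (v := v) (u := u) hE
  have hr := hT.conn a ha b hb
  rw [ExtActive, ExtActive, mk_mem_completeTiered hab, mk_mem_completeTiered hab, hmemE,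
    edgeKey_mk hab]
  have hcond : (∀ f ∈ E, ¬ EReach (E.erase f) a b → edgeLexLt s(a, b) f) ↔
      ∀ f ∈ branchEdges V E v u, ¬ EReach ((branchEdges V E v u).erase f) a b →
        edgeLexLt s(a, b) f := by
    constructor
    · intro h f hf hnr
      refine h f (hsub hf) fun hr' => ?_
      induction f with
      | _ p q =>
        have hm := Finset.erase_subset_erase s(p, q) hsub
        rcases hr.erase_cases p q with h1 | ⟨h1, h2⟩ | ⟨h1, h2⟩
        · exact hnr h1
        · exact hE.bridge p q (hsub hf)
            ((h1.mono hm).symm.trans (hr'.trans (h2.mono hm).symm))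
        · exact hE.bridge p q (hsub hf)
            ((h2.mono hm).trans (hr'.symm.trans (h1.mono hm)))
    · intro h f hf hnr
      by_cases hfb : f ∈ branchEdges V E v u
      · exact h f hfb fun h' => hnr (h'.mono (Finset.erase_subset_erase f hsub))
      · refine absurd (hr.mono fun e he => Finset.mem_erase.mpr ⟨?_, hsub he⟩) hnr
        rintro rfl
        exact hfb he
  have := mem_of_mem_branch ha
  have := mem_of_mem_branch hb
  rw [hcond]
  tauto

theorem filter_extActive_eq (hE : IsBridgeTree V E) (hv : v ∈ V) (hmin : ∀ x ∈ V, v ≤ x)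
    (t : ℕ → ℕ) :
    (completeTiered V t).filter (ExtActive E (completeTiered V t)) =
      ((V.erase v).filter fun u => s(v, u) ∈ E).biUnion fun u =>
        (((branch V E v u).filter fun x => t v < t x ∧ x < u).image fun x => s(v, x)) ∪
        (completeTiered (branch V E v u) t).filter
          (ExtActive (branchEdges V E v u) (completeTiered (branch V E v u) t)) := by
  have hnbr : ∀ {u}, s(v, u) ∈ E → u ∈ (V.erase v).filter fun u => s(v, u) ∈ E := fun hu =>
    Finset.mem_filter.mpr ⟨(Finset.mem_filter.mp (root_mem_branch hE hu)).1, hu⟩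
  ext e
  rw [Finset.mem_filter, Finset.mem_biUnion]
  constructor
  · rintro ⟨he, hact⟩
    obtain ⟨a, b, ha, hb, hab, ht, rfl⟩ := mem_completeTiered.mp he
    have hbv : b ≠ v := by have := hmin a ha; omega
    obtain ⟨w, hw, hbw⟩ := exists_branch hE hv hb hbv
    refine ⟨w, hnbr hw, Finset.mem_union.mpr ?_⟩
    by_cases hav : a = v
    · subst hav
      left
      exact Finset.mem_image.mpr ⟨b, Finset.mem_filter.mpr
        ⟨hbw, (extActive_min_iff hE hv hmin hw hbw t).mp hact⟩, rfl⟩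
    · right
      obtain ⟨u, hu, hau⟩ := exists_branch hE hv ha hav
      by_cases huw : u = w
      · subst huw
        have h := (extActive_branch_iff hE hau hbw hab t).mp hact
        exact Finset.mem_filter.mpr ⟨h.1, h⟩
      · exact absurd hact (not_extActive_of_branch_ne hE hmin hu hw huw hau hbw hab _)
  · rintro ⟨u, hu, h⟩
    have hu := (Finset.mem_filter.mp hu).2
    suffices ExtActive E (completeTiered V t) e from ⟨this.1, this⟩
    rcases Finset.mem_union.mp h with h | h
    · obtain ⟨x, hx, rfl⟩ := Finset.mem_image.mp h
      have hx := Finset.mem_filter.mp hx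
      exact (extActive_min_iff hE hv hmin hu hx.1 t).mpr hx.2
    · obtain ⟨he, hact⟩ := Finset.mem_filter.mp h
      obtain ⟨a, b, ha, hb, hab, -, rfl⟩ := mem_completeTiered.mp he
      exact (extActive_branch_iff hE ha hb hab t).mpr hact

theorem extActivity_eq_sum (hE : IsBridgeTree V E) (hv : v ∈ V) (hmin : ∀ x ∈ V, v ≤ x)
    (t : ℕ → ℕ) :
    extActivity E (completeTiered V t) =
      ((V.erase v).filter fun u => s(v, u) ∈ E).sum fun u =>
        ((branch V E v u).filter fun x => t v < t x ∧ x < u).card +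
          extActivity (branchEdges V E v u) (completeTiered (branch V E v u) t) := by
  rw [extActivity, filter_extActive_eq hE hv hmin t, Finset.card_biUnion]
  · refine Finset.sum_congr rfl fun u _ => ?_
    rw [Finset.card_union_of_disjoint, Finset.card_image_of_injective]
    · rfl
    · exact fun x y hxy => Sym2.congr_right.mp hxy
    · rw [Finset.disjoint_left]
      intro e h1 h2
      obtain ⟨x, -, rfl⟩ := Finset.mem_image.mp h1
      obtain ⟨a, b, ha, hb, -, -, he⟩ := mem_completeTiered.mp (Finset.mem_filter.mp h2).1
      have hva := ne_of_mem_branch ha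
      have hvb := ne_of_mem_branch hb
      rcases Sym2.eq_iff.mp he with ⟨h, -⟩ | ⟨-, h⟩
      exacts [hva h, hvb h]
  · intro u hu w hw huw
    have hu := (Finset.mem_filter.mp hu).2
    have hw := (Finset.mem_filter.mp hw).2
    have key : ∀ {z e}, e ∈ (((branch V E v z).filter fun x => t v < t x ∧ x < z).image
          fun x => s(v, x)) ∪ (completeTiered (branch V E v z) t).filter
            (ExtActive (branchEdges V E v z) (completeTiered (branch V E v z) t)) →
        (∃ x ∈ e, x ≠ v) ∧ ∀ x ∈ e, x ≠ v → x ∈ branch V E v z := by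
      intro z e he
      rcases Finset.mem_union.mp he with h | h
      · obtain ⟨x, hx, rfl⟩ := Finset.mem_image.mp h
        have hx := (Finset.mem_filter.mp hx).1
        refine ⟨⟨x, by simp, ne_of_mem_branch hx⟩, fun y hy hyv => ?_⟩
        rcases Sym2.mem_iff.mp hy with rfl | rfl
        exacts [absurd rfl hyv, hx]
      · obtain ⟨a, b, ha, hb, -, -, rfl⟩ := mem_completeTiered.mp (Finset.mem_filter.mp h).1
        refine ⟨⟨a, by simp, ne_of_mem_branch ha⟩, fun y hy _ => ?_⟩
        rcases Sym2.mem_iff.mp hy with rfl | rfl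
        exacts [ha, hb]
    refine Finset.disjoint_left.mpr fun e h1 h2 => ?_
    obtain ⟨⟨x, hx, hxv⟩, h⟩ := key h1
    exact huw (branch_unique hE hu hw (h x hx hxv) ((key h2).2 x hx hxv))

end Branches

theorem treeWeightAux_eq_extActivity (t : ℕ → ℕ) (fuel : ℕ) :
    ∀ (V : Finset ℕ) (E : Finset (Sym2 ℕ)), IsBridgeTree V E → V.card ≤ fuel →
      treeWeightAux t fuel V E = extActivity E (completeTiered V t) := by
  have hsmall : ∀ (V : Finset ℕ) (E : Finset (Sym2 ℕ)), V.card < 2 →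
      extActivity E (completeTiered V t) = 0 := by
    intro V E hV
    rw [extActivity, Finset.card_eq_zero, Finset.filter_eq_empty_iff]
    intro e he
    obtain ⟨a, b, ha, hb, hab, -⟩ := mem_completeTiered.mp he
    exact absurd (Finset.card_le_one.mp (by omega) a ha b hb) hab.ne
  induction fuel with
  | zero =>
    intro V E _ hV
    rw [hsmall V E (by omega), treeWeightAux]
  | succ fuel ih =>
    intro V E hE hV
    by_cases h : 2 ≤ V.card
    · have hne : V.Nonempty := Finset.card_pos.mp (by omega)
      rw [extActivity_eq_sum hE (V.min'_mem hne) (fun x hx => V.min'_le x hx) t, treeWeightAux,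
        dif_pos h]
      refine Finset.sum_congr rfl fun u _ => ?_
      refine congrArg _ (ih _ _ (isBridgeTree_branch hE) ?_)
      have h1 := Finset.card_erase_add_one (V.min'_mem hne)
      exact (Finset.card_filter_le _ _).trans (by omega)
    · rw [hsmall V E (by omega), treeWeightAux, dif_neg h]

/-- Let `T` be a tiered tree on `{1,…,n}` with tiering function `t`
and let `K_t` be the complete tiered graph with respect to `t`, with edges ordered
lexicographically by their endpoints.  Then the weight `w(T)` equals the external
activity of `T` in `K_t`. -/
theorem tiered_tree_weight_eq_external_activity
    (n m : ℕ) (hn : 1 ≤ n) (hm : 2 ≤ m)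
    (E : Finset (Sym2 ℕ)) (t : ℕ → ℕ)
    (hT : IsTreeOn (Finset.Icc 1 n) E)
    (ht : IsTieredOn (Finset.Icc 1 n) E m t) :
    treeWeight (Finset.Icc 1 n) E t = extActivity E (completeTiered (Finset.Icc 1 n) t) :=
  treeWeightAux_eq_extActivity t _ _ _ (isBridgeTree_of_isTreeOn hT) le_rfl
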